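/- arXiv:1110.6611 — 2 statements merged into one kernel-verified Lean document; each statement's English description precedes it below -/
import Mathlib

section
/- With the notation of the context (in particular n ≥ 2), the signed measure φ^{(0,0)} := σ − (y₀²⋯y_{n−1}²)(∫(1/t)dψ^{(0,0)})·δ₀ − a²z₀²⋯z_{n−2}²y₀²(∫(1/t)dη_{(n,n−1)})·(1/s)dξ(s) is positive (φ^{(0,0)}(E) ≥ 0 for every Borel set E) if and only if the signed measure φ := σ − y₀²(∫(1/t)dψ)·δ₀ − a²y₀²(∫(1/t)dη)·(1/s)dξ(s) is positive. Here δ₀ is the unit point mass at 0, and both integrals ∫(1/t)dψ and ∫(1/t)dψ^{(0,0)} are finite under the stated assumptions. -/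
open MeasureTheory
open scoped ENNReal

noncomputable section

/-- The `j`-th moment `γ_j(ν) := ∫ t^j dν(t)`. -/
noncomputable def mom (ν : MeasureTheory.Measure ℝ) (j : ℕ) : ℝ := ∫ t, t ^ j ∂ν

/-- The weights `w_j(ν) := (γ_{j+1}(ν)/γ_j(ν))^{1/2}` of the subnormal unilateral weighted
shift whose Berger measure is `ν`. -/
noncomputable def wgt (ν : MeasureTheory.Measure ℝ) (j : ℕ) : ℝ :=
  Real.sqrt (mom ν (j + 1) / mom ν j)

/-- `ν_{(n,i)}`: the pushforward under `t ↦ tⁿ` of the measure `(t^i/γ_i(ν)) dν(t)`. -/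
noncomputable def nuPow (ν : MeasureTheory.Measure ℝ) (n i : ℕ) : MeasureTheory.Measure ℝ :=
  (ν.withDensity fun t => ENNReal.ofReal (t ^ i / mom ν i)).map fun t => t ^ n

/-- `ν₁`: the measure `(t/γ₁(ν)) dν(t)`. -/
noncomputable def nuOne (ν : MeasureTheory.Measure ℝ) : MeasureTheory.Measure ℝ :=
  ν.withDensity fun t => ENNReal.ofReal (t / mom ν 1)

/-- `∫ (1/t) dμ(t)`, as an extended real (`(0 : ℝ≥0∞)⁻¹ = ∞`). -/
noncomputable def invInt (μ : MeasureTheory.Measure ℝ) : ℝ≥0∞ :=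
  ∫⁻ t, (ENNReal.ofReal t)⁻¹ ∂μ

theorem mom_zero (ν : Measure ℝ) [IsProbabilityMeasure ν] : mom ν 0 = 1 := by
  simp [mom]

theorem wgt_sq {ν : Measure ℝ} (hν : ∀ j, 0 < mom ν j) (j : ℕ) :
    wgt ν j ^ 2 = mom ν (j + 1) / mom ν j :=
  Real.sq_sqrt (div_pos (hν _) (hν _)).le

theorem prod_wgt_sq {ν : Measure ℝ} [IsProbabilityMeasure ν] (hν : ∀ j, 0 < mom ν j) (k : ℕ) :
    ∏ j ∈ Finset.range k, wgt ν j ^ 2 = mom ν k := by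
  induction k with
  | zero => simp [mom_zero]
  | succ k ih =>
    rw [Finset.prod_range_succ, ih, wgt_sq hν]
    exact mul_div_cancel₀ _ (hν k).ne'

theorem nuPow_zero (ν : Measure ℝ) [IsProbabilityMeasure ν] (n : ℕ) :
    nuPow ν n 0 = ν.map fun t => t ^ n := by
  simp [nuPow, mom_zero]

theorem mom_nuPow_zero (ν : Measure ℝ) [IsProbabilityMeasure ν] (n : ℕ) :
    mom (nuPow ν n 0) 1 = mom ν n := by
  rw [nuPow_zero, mom, integral_map (by fun_prop) (by fun_prop)]
  simp [mom]

theorem invInt_nuOne {ν : Measure ℝ} (hν : 0 < mom ν 1) :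
    invInt (nuOne ν) = (ENNReal.ofReal (mom ν 1))⁻¹ * ν (Set.Ioi 0) := by
  rw [invInt, nuOne, lintegral_withDensity_eq_lintegral_mul _ (by fun_prop) (by fun_prop),
    ← lintegral_indicator_const measurableSet_Ioi]
  refine lintegral_congr fun t => ?_
  by_cases ht : 0 < t
  · have h0 : ENNReal.ofReal t ≠ 0 := by simpa using ht
    simp only [Pi.mul_apply, Set.indicator, Set.mem_Ioi, ht, if_true]
    rw [ENNReal.ofReal_div_of_pos hν, ENNReal.div_eq_inv_mul, mul_assoc,
      ENNReal.mul_inv_cancel h0 ENNReal.ofReal_ne_top, mul_one]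
  · have h : t / mom ν 1 ≤ 0 := div_nonpos_of_nonpos_of_nonneg (not_lt.mp ht) hν.le
    simp [Set.indicator, ht, ENNReal.ofReal_of_nonpos h]

theorem map_pow_Ioi_zero {ν : Measure ℝ} (hν : ν (Set.Iio 0) = 0) {n : ℕ} (hn : n ≠ 0) :
    (ν.map fun t => t ^ n) (Set.Ioi 0) = ν (Set.Ioi 0) := by
  rw [Measure.map_apply (by fun_prop) measurableSet_Ioi]
  have h : ∀ᵐ t ∂ν, 0 ≤ t := by
    rw [ae_iff]
    simpa [Set.Iio] using hν
  refine measure_congr ?_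
  filter_upwards [h] with t ht
  refine propext ⟨fun h => ht.lt_of_ne' ?_, fun h => pow_pos h n⟩
  rintro rfl
  have h : (0 : ℝ) < 0 ^ n := h
  simp [hn] at h

theorem invInt_nuPow_pred {ν : Measure ℝ} {n : ℕ} (hn : n ≠ 0) (hm : 0 < mom ν (n - 1))
    (hν : invInt ν ≠ ⊤) :
    invInt (nuPow ν n (n - 1)) = (ENNReal.ofReal (mom ν (n - 1)))⁻¹ * invInt ν := by
  obtain ⟨k, rfl⟩ := Nat.exists_eq_succ_of_ne_zero hn
  simp only [Nat.succ_eq_add_one, Nat.add_sub_cancel] at hm ⊢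
  rw [invInt, nuPow, lintegral_map (by fun_prop) (by fun_prop),
    lintegral_withDensity_eq_lintegral_mul _ (by fun_prop) (by fun_prop), invInt,
    ← lintegral_const_mul _ (by fun_prop)]
  refine lintegral_congr_ae ?_
  filter_upwards [ae_lt_top (by fun_prop) hν] with t ht
  have ht : 0 < t := by simpa using ht
  have hk := pow_pos ht k
  rw [Pi.mul_apply, ← ENNReal.ofReal_inv_of_pos (pow_pos ht _), ← ENNReal.ofReal_inv_of_pos hm,
    ← ENNReal.ofReal_inv_of_pos ht, ← ENNReal.ofReal_mul (by positivity),
    ← ENNReal.ofReal_mul (by positivity)]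
  congr 1
  field_simp
  rw [pow_succ]

/-- Proposition 6.1(ii): with
`φ := σ − y₀²(∫(1/t)dψ)·δ₀ − a²y₀²(∫(1/t)dη)·(1/s)dξ(s)` and
`φ^{(0,0)} := σ − (y₀²⋯y_{n−1}²)(∫(1/t)dψ^{(0,0)})·δ₀
− a²z₀²⋯z_{n−2}²y₀²(∫(1/t)dη_{(n,n−1)})·(1/s)dξ(s)`,
the signed measure `φ^{(0,0)}` is positive iff `φ` is positive; moreover the integrals
`∫(1/t)dψ` and `∫(1/t)dψ^{(0,0)}` are finite. -/
theorem phi00_nonneg_iff_phi_nonneg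
    (σ τ ξ η : Measure ℝ)
    [IsProbabilityMeasure σ] [IsProbabilityMeasure τ]
    [IsProbabilityMeasure ξ] [IsProbabilityMeasure η]
    (hσ0 : σ (Set.Iio 0) = 0) (hτ0 : τ (Set.Iio 0) = 0)
    (hξ0 : ξ (Set.Iio 0) = 0) (hη0 : η (Set.Iio 0) = 0)
    (hσc : ∃ R : ℝ, σ (Set.Ioi R) = 0) (hτc : ∃ R : ℝ, τ (Set.Ioi R) = 0)
    (hξc : ∃ R : ℝ, ξ (Set.Ioi R) = 0) (hηc : ∃ R : ℝ, η (Set.Ioi R) = 0)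
    (hσm : ∀ j, 0 < mom σ j) (hτm : ∀ j, 0 < mom τ j)
    (hξm : ∀ j, 0 < mom ξ j) (hηm : ∀ j, 0 < mom η j)
    (a : ℝ) (ha : 0 < a) (n : ℕ) (hn : 2 ≤ n)
    (hξfin : invInt ξ ≠ ⊤) (hηfin : invInt η ≠ ⊤) :
    -- the integrals of 1/t against (the parts of) ψ and ψ^{(0,0)} are finite
    invInt (nuOne τ) ≠ ⊤ ∧ invInt (nuOne (nuPow τ n 0)) ≠ ⊤ ∧
    invInt (nuPow η n (n - 1)) ≠ ⊤ ∧
    -- φ^{(0,0)} ≥ 0  ↔  φ ≥ 0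
    ((∀ E : Set ℝ, MeasurableSet E →
        ENNReal.ofReal ((∏ j ∈ Finset.range n, wgt τ j ^ 2) *
            ((invInt (nuOne (nuPow τ n 0))).toReal -
              a ^ 2 * (∏ j ∈ Finset.range (n - 1), wgt η j ^ 2) /
                (∏ j ∈ Finset.range (n - 1), wgt τ (j + 1) ^ 2) *
                (invInt ξ).toReal * (invInt (nuPow η n (n - 1))).toReal)) *
            Measure.dirac (0 : ℝ) E +
          ENNReal.ofReal (a ^ 2 * (∏ j ∈ Finset.range (n - 1), wgt η j ^ 2) *
              wgt τ 0 ^ 2 * (invInt (nuPow η n (n - 1))).toReal) *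
            (ξ.withDensity fun s => (ENNReal.ofReal s)⁻¹) E ≤
        σ E +
          ENNReal.ofReal (-((∏ j ∈ Finset.range n, wgt τ j ^ 2) *
            ((invInt (nuOne (nuPow τ n 0))).toReal -
              a ^ 2 * (∏ j ∈ Finset.range (n - 1), wgt η j ^ 2) /
                (∏ j ∈ Finset.range (n - 1), wgt τ (j + 1) ^ 2) *
                (invInt ξ).toReal * (invInt (nuPow η n (n - 1))).toReal))) *
            Measure.dirac (0 : ℝ) E) ↔
      (∀ E : Set ℝ, MeasurableSet E →
        ENNReal.ofReal (wgt τ 0 ^ 2 *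
            ((invInt (nuOne τ)).toReal -
              a ^ 2 * (invInt ξ).toReal * (invInt η).toReal)) *
            Measure.dirac (0 : ℝ) E +
          ENNReal.ofReal (a ^ 2 * wgt τ 0 ^ 2 * (invInt η).toReal) *
            (ξ.withDensity fun s => (ENNReal.ofReal s)⁻¹) E ≤
        σ E +
          ENNReal.ofReal (-(wgt τ 0 ^ 2 *
            ((invInt (nuOne τ)).toReal -
              a ^ 2 * (invInt ξ).toReal * (invInt η).toReal))) *
            Measure.dirac (0 : ℝ) E)) := by
  have hn0 : n ≠ 0 := by omega
  have hτ₁ := invInt_nuOne (hτm 1)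
  have hτn : invInt (nuOne (nuPow τ n 0)) =
      (ENNReal.ofReal (mom τ n))⁻¹ * τ (Set.Ioi 0) := by
    rw [invInt_nuOne (by rw [mom_nuPow_zero]; exact hτm n), mom_nuPow_zero, nuPow_zero,
      map_pow_Ioi_zero hτ0 hn0]
  have hηn := invInt_nuPow_pred hn0 (hηm (n - 1)) hηfin
  have inv_ne_top {x : ℝ} (hx : 0 < x) : (ENNReal.ofReal x)⁻¹ ≠ ⊤ := by simpa using hx
  refine ⟨?_, ?_, ?_, ?_⟩
  · rw [hτ₁]
    exact ENNReal.mul_ne_top (inv_ne_top (hτm 1)) (measure_ne_top _ _)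
  · rw [hτn]
    exact ENNReal.mul_ne_top (inv_ne_top (hτm n)) (measure_ne_top _ _)
  · rw [hηn]
    exact ENNReal.mul_ne_top (inv_ne_top (hηm _)) hηfin
  have hy : ∏ j ∈ Finset.range n, wgt τ j ^ 2 =
      (∏ j ∈ Finset.range (n - 1), wgt τ (j + 1) ^ 2) * wgt τ 0 ^ 2 := by
    rw [← Finset.prod_range_succ' (fun j => wgt τ j ^ 2), Nat.sub_add_cancel (by omega)]
  have hy0 : wgt τ 0 ^ 2 = mom τ 1 := by rw [wgt_sq hτm, mom_zero, div_one]
  have hz := prod_wgt_sq hηm (n - 1)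
  have hyn := prod_wgt_sq hτm n
  have e₁ : (invInt (nuOne τ)).toReal = (mom τ 1)⁻¹ * (τ (Set.Ioi 0)).toReal := by
    rw [hτ₁, ENNReal.toReal_mul, ENNReal.toReal_inv, ENNReal.toReal_ofReal (hτm 1).le]
  have e₂ : (invInt (nuOne (nuPow τ n 0))).toReal = (mom τ n)⁻¹ * (τ (Set.Ioi 0)).toReal := by
    rw [hτn, ENNReal.toReal_mul, ENNReal.toReal_inv, ENNReal.toReal_ofReal (hτm n).le]
  have e₃ : (invInt (nuPow η n (n - 1))).toReal = (mom η (n - 1))⁻¹ * (invInt η).toReal := by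
    rw [hηn, ENNReal.toReal_mul, ENNReal.toReal_inv, ENNReal.toReal_ofReal (hηm _).le]
  have hτ1 := hτm 1
  have hτn' := hτm n
  have hη' := hηm (n - 1)
  rw [hyn, hy0] at hy
  rw [hyn, hz, hy0, e₁, e₂, e₃]
  set Y := ∏ j ∈ Finset.range (n - 1), wgt τ (j + 1) ^ 2
  have hY : Y ≠ 0 := left_ne_zero_of_mul (hy ▸ hτn'.ne')
  have hδ : mom τ n * ((mom τ n)⁻¹ * (τ (Set.Ioi 0)).toReal -
        a ^ 2 * mom η (n - 1) / Y * (invInt ξ).toReal *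
          ((mom η (n - 1))⁻¹ * (invInt η).toReal)) =
      mom τ 1 * ((mom τ 1)⁻¹ * (τ (Set.Ioi 0)).toReal -
        a ^ 2 * (invInt ξ).toReal * (invInt η).toReal) := by
    rw [hy]
    field_simp
  have hξ : a ^ 2 * mom η (n - 1) * mom τ 1 * ((mom η (n - 1))⁻¹ * (invInt η).toReal) =
      a ^ 2 * mom τ 1 * (invInt η).toReal := by
    field_simp
  rw [hδ, hξ]

end
end

section
/- (Six-point Test) Let T = (T₁,T₂) be a commuting 2-variable weighted shift with weight sequences α and β. Then T is jointly hyponormal, i.e. ⟨[T₁*,T₁]f,f⟩ + ⟨[T₂*,T₁]g,f⟩ + ⟨[T₁*,T₂]f,g⟩ + ⟨[T₂*,T₂]g,g⟩ ≥ 0 for all f,g ∈ ℓ²(ℤ₊²), if and only if for every k ∈ ℤ₊² the 2×2 real matrix with diagonal entries α_{k+ε₁}² − α_k² and β_{k+ε₂}² − β_k², and off-diagonal entries α_{k+ε₂}β_{k+ε₁} − α_kβ_k, is positive semidefinite; equivalently, for all k: α_{k+ε₁}² ≥ α_k², β_{k+ε₂}² ≥ β_k², and (α_{k+ε₁}² −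 α_k²)(β_{k+ε₂}² − β_k²) ≥ (α_{k+ε₂}β_{k+ε₁} − α_kβ_k)². -/
open MeasureTheory
open scoped ENNReal

noncomputable section

/-- The Hilbert space `ℓ²(ℤ₊²)`. -/
abbrev H2 : Type := lp (fun _ : ℕ × ℕ => ℂ) 2

/-- The canonical orthonormal basis vectors of `ℓ²(ℤ₊²)`. -/
noncomputable def e2 (k : ℕ × ℕ) : H2 := lp.single 2 k 1

/-- The commutator `[S,T] := ST − TS`. -/
noncomputable def opComm (S T : H2 →L[ℂ] H2) : H2 →L[ℂ] H2 := S ∘L T - T ∘L S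

open scoped ComplexOrder

lemma inner_e2_left (k : ℕ × ℕ) (f : H2) : inner ℂ (e2 k) f = f k := by
  simp [e2, lp.inner_single_left]

lemma e2_apply (k j : ℕ × ℕ) : e2 k j = if j = k then 1 else 0 := by
  simp [e2, lp.single_apply, Pi.single_apply]

/-- `T` is the weighted shift `e_k ↦ w_k e_{σ k}`. -/
def IsWeightedShift (σ : ℕ × ℕ → ℕ × ℕ) (w : ℕ × ℕ → ℝ) (T : H2 →L[ℂ] H2) : Prop :=
  ∀ k, T (e2 k) = (w k : ℂ) • e2 (σ k)

namespace IsWeightedShift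

variable {σ τ : ℕ × ℕ → ℕ × ℕ} {v w : ℕ × ℕ → ℝ} {S T : H2 →L[ℂ] H2}

lemma adjoint_apply (hT : IsWeightedShift σ w T) (f : H2) (k : ℕ × ℕ) :
    ContinuousLinearMap.adjoint T f k = w k * f (σ k) := by
  rw [← inner_e2_left, ContinuousLinearMap.adjoint_inner_right, hT, inner_smul_left,
    inner_e2_left, Complex.conj_ofReal]

lemma apply_map (hT : IsWeightedShift σ w T) (hσ : σ.Injective) (f : H2) (k : ℕ × ℕ) :
    T f (σ k) = w k * f k := by
  have h : ContinuousLinearMap.adjoint T (e2 (σ k)) = (w k : ℂ) • e2 k := by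
    ext j
    rw [hT.adjoint_apply, lp.coeFn_smul, Pi.smul_apply, e2_apply, e2_apply, smul_eq_mul]
    by_cases hj : j = k
    · simp [hj]
    · simp [hj, hσ.ne hj]
  rw [← inner_e2_left, ← ContinuousLinearMap.adjoint_inner_left, h, inner_smul_left,
    inner_e2_left, Complex.conj_ofReal]

lemma apply_of_notMem_range (hT : IsWeightedShift σ w T) (f : H2) {j : ℕ × ℕ}
    (hj : j ∉ Set.range σ) : T f j = 0 := by
  have h : ContinuousLinearMap.adjoint T (e2 j) = 0 := by
    ext k
    have hk : σ k ≠ j := fun hk => hj ⟨k, hk⟩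
    rw [hT.adjoint_apply, e2_apply]
    simp [hk]
  rw [← inner_e2_left, ← ContinuousLinearMap.adjoint_inner_left, h, inner_zero_left]

lemma opComm_adjoint_apply_map (hT : IsWeightedShift σ w T) (hS : IsWeightedShift τ v S)
    (hσ : σ.Injective) (hστ : ∀ k, τ (σ k) = σ (τ k)) (f : H2) (k : ℕ × ℕ) :
    opComm (ContinuousLinearMap.adjoint S) T f (σ k) =
      ((w (τ k) * v (σ k) - w k * v k : ℝ) : ℂ) * f (τ k) := by
  simp only [opComm, sub_apply, ContinuousLinearMap.comp_apply,
    lp.coeFn_sub, Pi.sub_apply]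
  rw [hS.adjoint_apply, hT.apply_map hσ, hS.adjoint_apply, hστ, hT.apply_map hσ]
  push_cast
  ring

lemma opComm_adjoint_apply_of_notMem_range (hT : IsWeightedShift σ w T)
    (hS : IsWeightedShift τ v S) (f : H2) {j : ℕ × ℕ} (hj : j ∉ Set.range σ) :
    opComm (ContinuousLinearMap.adjoint S) T f j = v j * T f (τ j) := by
  simp only [opComm, sub_apply, ContinuousLinearMap.comp_apply,
    lp.coeFn_sub, Pi.sub_apply]
  rw [hS.adjoint_apply, hT.apply_of_notMem_range _ hj, sub_zero]

/-- The entries of row `σ` of the operator matrix, paired with `f`, summed over the range of `σ`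
and over its complement, where only the nonnegative diagonal contribution survives. -/
lemma exists_inner_opComm_eq (hT : IsWeightedShift σ w T) (hS : IsWeightedShift τ v S)
    (hσ : σ.Injective) (hστ : ∀ k, τ (σ k) = σ (τ k))
    (hrange : ∀ j ∉ Set.range σ, τ j ∉ Set.range σ) (f g : H2) :
    ∃ c : ℂ, 0 ≤ c ∧ HasSum (fun k => star (f (σ k)) *
        (((w (σ k) ^ 2 - w k ^ 2 : ℝ) : ℂ) * f (σ k) +
          ((w (τ k) * v (σ k) - w k * v k : ℝ) : ℂ) * g (τ k)))
      (inner ℂ f (opComm (ContinuousLinearMap.adjoint T) T f) +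
        inner ℂ f (opComm (ContinuousLinearMap.adjoint S) T g) - c) := by
  set h : H2 := opComm (ContinuousLinearMap.adjoint T) T f +
    opComm (ContinuousLinearMap.adjoint S) T g with hh
  have hsum : Summable fun k => inner ℂ (f k) (h k) := lp.summable_inner f h
  refine ⟨∑' j : ↥(Set.range σ)ᶜ, inner ℂ (f j) (h j), tsum_nonneg ?_, ?_⟩
  · rintro ⟨j, hj⟩
    have hhj : h j = ((w j ^ 2 : ℝ) : ℂ) * f j := by
      rw [hh, lp.coeFn_add, Pi.add_apply, hT.opComm_adjoint_apply_of_notMem_range hT _ hj,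
        hT.opComm_adjoint_apply_of_notMem_range hS _ hj, hT.apply_map hσ,
        hT.apply_of_notMem_range _ (hrange j hj)]
      push_cast
      ring
    have hval : inner ℂ (f j) (h j) = ((w j ^ 2 * Complex.normSq (f j) : ℝ) : ℂ) := by
      rw [hhj, RCLike.inner_apply, mul_assoc, Complex.mul_conj]
      push_cast
      ring
    rw [hval]
    exact_mod_cast mul_nonneg (sq_nonneg _) (Complex.normSq_nonneg _)
  · have hsplit := hsum.tsum_subtype_add_tsum_subtype_compl (Set.range σ)
    rw [tsum_range (fun k => inner ℂ (f k) (h k)) hσ] at hsplit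
    rw [← inner_add_right, ← hh, lp.inner_eq_tsum, ← hsplit, add_sub_cancel_right]
    refine (hsum.comp_injective hσ).hasSum.congr_fun fun k => ?_
    rw [Function.comp_apply, RCLike.inner_apply, hh, lp.coeFn_add, Pi.add_apply,
      hT.opComm_adjoint_apply_map hT hσ (fun _ => rfl), hT.opComm_adjoint_apply_map hS hσ hστ,
      ← pow_two, ← pow_two, mul_comm]
    rfl

end IsWeightedShift

lemma forall_quadratic_nonneg_iff {a b c : ℝ} :
    (∀ x y : ℝ, 0 ≤ a * x ^ 2 + 2 * c * x * y + b * y ^ 2) ↔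
      0 ≤ a ∧ 0 ≤ b ∧ c ^ 2 ≤ a * b := by
  constructor
  · intro h
    refine ⟨by simpa using h 1 0, by simpa using h 0 1, ?_⟩
    have hd : discrim a (2 * c) b ≤ 0 :=
      discrim_le_zero fun x => by linarith [h x 1]
    rw [discrim] at hd
    linarith
  · rintro ⟨ha, hb, hc⟩ x y
    rcases ha.eq_or_lt with rfl | ha
    · have : c = 0 := by nlinarith
      subst this
      nlinarith [mul_nonneg hb (sq_nonneg y)]
    · refine nonneg_of_mul_nonneg_right ?_ ha
      nlinarith [sq_nonneg (a * x + c * y), mul_nonneg (sub_nonneg.2 hc) (sq_nonneg y)]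

lemma posSemidef_two_iff {a b c : ℝ} :
    (Matrix.of ![![a, c], ![c, b]]).PosSemidef ↔ 0 ≤ a ∧ 0 ≤ b ∧ c ^ 2 ≤ a * b := by
  rw [← forall_quadratic_nonneg_iff, Matrix.posSemidef_iff_dotProduct_mulVec]
  constructor
  · rintro ⟨-, h⟩ x y
    have := h ![x, y]
    simp [Matrix.mulVec, dotProduct, Fin.sum_univ_two] at this
    linarith
  · intro h
    refine ⟨?_, fun x => ?_⟩
    · ext i j
      fin_cases i <;> fin_cases j <;> simp
    · have := h (x 0) (x 1)
      simp [Matrix.mulVec, dotProduct, Fin.sum_univ_two]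
      linarith

lemma complex_quadratic_nonneg {a b c : ℝ} (ha : 0 ≤ a) (hb : 0 ≤ b) (hc : c ^ 2 ≤ a * b)
    (z w : ℂ) : 0 ≤ star z * (a * z + c * w) + star w * (b * w + c * z) := by
  have h := forall_quadratic_nonneg_iff.2 ⟨ha, hb, hc⟩
  rw [Complex.nonneg_iff]
  constructor
  · simp
    linarith [h z.re w.re, h z.im w.im]
  · simp
    ring

section JointHyponormality

variable {σ τ : ℕ × ℕ → ℕ × ℕ} {v w : ℕ × ℕ → ℝ} {S T : H2 →L[ℂ] H2}

/-- The quadratic form of the operator matrix `([Tⱼ*,Tᵢ])` with `T₁ = T`, `T₂ = S`. -/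
def jointForm (T S : H2 →L[ℂ] H2) (f g : H2) : ℂ :=
  inner ℂ f (opComm (ContinuousLinearMap.adjoint T) T f) +
  inner ℂ f (opComm (ContinuousLinearMap.adjoint S) T g) +
  inner ℂ g (opComm (ContinuousLinearMap.adjoint T) S f) +
  inner ℂ g (opComm (ContinuousLinearMap.adjoint S) S g)

lemma jointForm_nonneg (hT : IsWeightedShift σ w T) (hS : IsWeightedShift τ v S)
    (hσ : σ.Injective) (hτ : τ.Injective) (hστ : ∀ k, τ (σ k) = σ (τ k))
    (hσrange : ∀ j ∉ Set.range σ, τ j ∉ Set.range σ)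
    (hτrange : ∀ j ∉ Set.range τ, σ j ∉ Set.range τ)
    (h : ∀ k, 0 ≤ w (σ k) ^ 2 - w k ^ 2 ∧ 0 ≤ v (τ k) ^ 2 - v k ^ 2 ∧
      (w (τ k) * v (σ k) - w k * v k) ^ 2 ≤
        (w (σ k) ^ 2 - w k ^ 2) * (v (τ k) ^ 2 - v k ^ 2)) (f g : H2) :
    0 ≤ jointForm T S f g := by
  obtain ⟨c, hc, hf⟩ := hT.exists_inner_opComm_eq hS hσ hστ hσrange f g
  obtain ⟨d, hd, hg⟩ := hS.exists_inner_opComm_eq hT hτ (fun k => (hστ k).symm) hτrange g f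
  have hnonneg := (hf.add hg).nonneg fun k => by
    obtain ⟨ha, hb, hab⟩ := h k
    have := complex_quadratic_nonneg ha hb hab (f (σ k)) (g (τ k))
    rwa [mul_comm (v (σ k)), mul_comm (v k)]
  convert add_nonneg hnonneg (add_nonneg hc hd) using 1
  rw [jointForm]
  ring

lemma jointForm_smul_e2 (hT : IsWeightedShift σ w T) (hS : IsWeightedShift τ v S)
    (hσ : σ.Injective) (hτ : τ.Injective) (hστ : ∀ k, τ (σ k) = σ (τ k))
    (k : ℕ × ℕ) (x y : ℝ) :
    jointForm T S ((x : ℂ) • e2 (σ k)) ((y : ℂ) • e2 (τ k)) =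
      (((w (σ k) ^ 2 - w k ^ 2) * x ^ 2 + 2 * (w (τ k) * v (σ k) - w k * v k) * x * y +
        (v (τ k) ^ 2 - v k ^ 2) * y ^ 2 : ℝ) : ℂ) := by
  simp only [jointForm, inner_smul_left, inner_e2_left]
  rw [hT.opComm_adjoint_apply_map hT hσ (fun _ => rfl), hT.opComm_adjoint_apply_map hS hσ hστ,
    hS.opComm_adjoint_apply_map hT hτ (fun k => (hστ k).symm),
    hS.opComm_adjoint_apply_map hS hτ (fun _ => rfl)]
  simp only [lp.coeFn_smul, Pi.smul_apply, e2_apply, if_true, smul_eq_mul, mul_one,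
    Complex.conj_ofReal]
  push_cast
  ring

end JointHyponormality

/-- (Six-point Test) A commuting 2-variable weighted shift `T = (T₁,T₂)` is jointly
hyponormal iff for every `k` the 2×2 matrix
`[[α_{k+ε₁}² − α_k², α_{k+ε₂}β_{k+ε₁} − α_kβ_k], [α_{k+ε₂}β_{k+ε₁} − α_kβ_k, β_{k+ε₂}² − β_k²]]`
is positive semidefinite, equivalently iff the corresponding scalar inequalities hold. -/
theorem six_point_test
    (α β : ℕ × ℕ → ℝ)
    (hαpos : ∀ k, 0 < α k) (hβpos : ∀ k, 0 < β k)
    (hαbdd : ∃ C : ℝ, ∀ k, α k ≤ C) (hβbdd : ∃ C : ℝ, ∀ k, β k ≤ C)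
    (T₁ T₂ : H2 →L[ℂ] H2)
    (hT₁ : ∀ k : ℕ × ℕ, T₁ (e2 k) = (α k : ℂ) • e2 (k.1 + 1, k.2))
    (hT₂ : ∀ k : ℕ × ℕ, T₂ (e2 k) = (β k : ℂ) • e2 (k.1, k.2 + 1))
    (hcomm : ∀ k : ℕ × ℕ, β (k.1 + 1, k.2) * α k = α (k.1, k.2 + 1) * β k) :
    List.TFAE [
      -- joint hyponormality: the operator matrix ([Tⱼ*,Tᵢ]) is positive semidefinite
      (∀ f g : H2, ∃ r : ℝ, 0 ≤ r ∧
        @inner ℂ H2 _ f (opComm (ContinuousLinearMap.adjoint T₁) T₁ f) +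
        @inner ℂ H2 _ f (opComm (ContinuousLinearMap.adjoint T₂) T₁ g) +
        @inner ℂ H2 _ g (opComm (ContinuousLinearMap.adjoint T₁) T₂ f) +
        @inner ℂ H2 _ g (opComm (ContinuousLinearMap.adjoint T₂) T₂ g) = (r : ℂ)),
      -- the six-point-test matrices are positive semidefinite
      (∀ k : ℕ × ℕ,
        (Matrix.of
          ![![α (k.1 + 1, k.2) ^ 2 - α k ^ 2,
              α (k.1, k.2 + 1) * β (k.1 + 1, k.2) - α k * β k],
            ![α (k.1, k.2 + 1) * β (k.1 + 1, k.2) - α k * β k,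
              β (k.1, k.2 + 1) ^ 2 - β k ^ 2]]).PosSemidef),
      -- the equivalent scalar inequalities
      (∀ k : ℕ × ℕ,
        α k ^ 2 ≤ α (k.1 + 1, k.2) ^ 2 ∧
        β k ^ 2 ≤ β (k.1, k.2 + 1) ^ 2 ∧
        (α (k.1, k.2 + 1) * β (k.1 + 1, k.2) - α k * β k) ^ 2 ≤
          (α (k.1 + 1, k.2) ^ 2 - α k ^ 2) * (β (k.1, k.2 + 1) ^ 2 - β k ^ 2))] := by
  have hT : IsWeightedShift (fun k => (k.1 + 1, k.2)) α T₁ := hT₁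
  have hS : IsWeightedShift (fun k => (k.1, k.2 + 1)) β T₂ := hT₂
  have hσ : Function.Injective fun k : ℕ × ℕ => (k.1 + 1, k.2) := fun a b h => by
    simpa [Prod.ext_iff] using h
  have hτ : Function.Injective fun k : ℕ × ℕ => (k.1, k.2 + 1) := fun a b h => by
    simpa [Prod.ext_iff] using h
  tfae_have 2 ↔ 3 := by
    simp only [posSemidef_two_iff, sub_nonneg]
  tfae_have 1 → 3 := fun h k => by
    rw [← sub_nonneg, ← sub_nonneg (b := β k ^ 2), ← forall_quadratic_nonneg_iff]
    intro x y
    obtain ⟨r, hr, hxy⟩ := h ((x : ℂ) • e2 (k.1 + 1, k.2)) ((y : ℂ) • e2 (k.1, k.2 + 1))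
    have hform := (jointForm_smul_e2 hT hS hσ hτ (fun _ => rfl) k x y).symm.trans hxy
    rwa [Complex.ofReal_injective hform]
  tfae_have 3 → 1 := fun h f g => by
    have hnonneg : 0 ≤ jointForm T₁ T₂ f g := by
      refine jointForm_nonneg hT hS hσ hτ (fun _ => rfl) ?_ ?_ (fun k => ?_) f g
      · rintro j hj ⟨i, hi⟩
        simp only [Prod.mk.injEq] at hi
        exact hj ⟨(i.1, j.2), Prod.ext hi.1 rfl⟩
      · rintro j hj ⟨i, hi⟩
        simp only [Prod.mk.injEq] at hi
        exact hj ⟨(j.1, i.2), Prod.ext rfl hi.2⟩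
      · simpa only [sub_nonneg] using h k
    obtain ⟨r, hr, hrf⟩ := RCLike.nonneg_iff_exists_ofReal.1 hnonneg
    exact ⟨r, hr, hrf.symm⟩
  tfae_finish

end
end
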